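/- For every fixed p ∈ (1, 2] there exists a constant c_p > 0 such that for all n ≥ 1 and all ε ∈ (0, 1/2], the unit ball B_p^n of ℓ_p^n admits a symmetric (2,ε)-covering consisting of at most c_p^n · (1 + log₂(1/ε)) · (1/ε)^{n/p} sets: i.e., there exist points c_1,…,c_N ∈ ℝⁿ and origin-symmetric convex bodies S_1,…,S_N with N ≤ c_p^n·(1 + log₂(1/ε))·(1/ε)^{n/p}, B_p^n ⊆ ⋃_{j=1}^N (c_j + S_j) and c_j + 2S_j ⊆ (1+ε)·B_p^n for every j. -/

import Mathlib

open Pointwise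

/-- The `ℓ_p` norm on ℝⁿ, `‖x‖_p = (Σᵢ |xᵢ|^p)^{1/p}`. -/
noncomputable def lpnorm (p : ℝ) (n : ℕ) (x : Fin n → ℝ) : ℝ :=
  (∑ i, |x i| ^ p) ^ (1 / p)

lemma abs_rpow_sub_two_mul_of_nonneg {p x : ℝ} (hp : 1 < p) (hx : 0 ≤ x) :
    |x| ^ (p - 2) * x = x ^ (p - 1) := by
  rcases hx.eq_or_lt with rfl | hx
  · rw [mul_zero, Real.zero_rpow (by linarith)]
  · rw [abs_of_pos hx, ← Real.rpow_add_one hx.ne']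
    congr 1
    ring

lemma abs_rpow_sub_two_mul_of_nonpos {p x : ℝ} (hp : 1 < p) (hx : x ≤ 0) :
    |x| ^ (p - 2) * x = -(-x) ^ (p - 1) := by
  rw [← abs_rpow_sub_two_mul_of_nonneg hp (neg_nonneg.2 hx), abs_neg]
  ring

/-- Monotonicity and `(p - 1)`-Hölder continuity of `x ↦ |x| ^ (p - 2) * x`. -/
lemma abs_rpow_sub_two_mul_sub_mem_Icc {p a b : ℝ} (hp : 1 < p) (hp2 : p ≤ 2) (hab : a ≤ b) :
    |b| ^ (p - 2) * b - |a| ^ (p - 2) * a ∈ Set.Icc 0 (2 * (b - a) ^ (p - 1)) := by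
  have hq : 0 ≤ p - 1 := by linarith
  have hpow : 0 ≤ (b - a) ^ (p - 1) := Real.rpow_nonneg (by linarith) _
  rcases le_total 0 a with ha | ha
  · rw [abs_rpow_sub_two_mul_of_nonneg hp ha, abs_rpow_sub_two_mul_of_nonneg hp (ha.trans hab)]
    have h1 := Real.rpow_le_rpow ha hab hq
    have h2 := Real.rpow_add_le_add_rpow ha (sub_nonneg.2 hab) hq (by linarith)
    rw [add_sub_cancel] at h2
    constructor <;> linarith
  rcases le_total b 0 with hb | hb
  · rw [abs_rpow_sub_two_mul_of_nonpos hp ha, abs_rpow_sub_two_mul_of_nonpos hp hb]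
    have h1 := Real.rpow_le_rpow (neg_nonneg.2 hb) (neg_le_neg hab) hq
    have h2 := Real.rpow_add_le_add_rpow (neg_nonneg.2 hb) (sub_nonneg.2 hab) hq (by linarith)
    rw [show -b + (b - a) = -a by ring] at h2
    constructor <;> linarith
  · rw [abs_rpow_sub_two_mul_of_nonpos hp ha, abs_rpow_sub_two_mul_of_nonneg hp hb]
    have h1 := Real.rpow_le_rpow hb (show b ≤ b - a by linarith) hq
    have h2 := Real.rpow_le_rpow (neg_nonneg.2 ha) (show -a ≤ b - a by linarith) hq
    have h3 := Real.rpow_nonneg hb (p - 1)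
    have h4 := Real.rpow_nonneg (neg_nonneg.2 ha) (p - 1)
    constructor <;> linarith

lemma abs_add_rpow_sub_mem_Icc_of_pos {p y : ℝ} (hp : 1 < p) (hp2 : p ≤ 2) (x : ℝ) (hy : 0 < y) :
    |x + y| ^ p - |x| ^ p - p * (|x| ^ (p - 2) * x) * y ∈ Set.Icc 0 (4 * |y| ^ p) := by
  obtain ⟨c, ⟨hxc, hcy⟩, hc⟩ := exists_hasDerivAt_eq_slope (fun x : ℝ ↦ |x| ^ p)
    (fun x ↦ p * |x| ^ (p - 2) * x) (show x < x + y by linarith)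
    (fun z _ ↦ (hasDerivAt_abs_rpow z hp).continuousAt.continuousWithinAt)
    (fun z _ ↦ hasDerivAt_abs_rpow z hp)
  rw [add_sub_cancel_left, eq_div_iff hy.ne'] at hc
  obtain ⟨h1, h2⟩ := abs_rpow_sub_two_mul_sub_mem_Icc hp hp2 hxc.le
  have h3 : (c - x) ^ (p - 1) ≤ y ^ (p - 1) :=
    Real.rpow_le_rpow (by linarith) (by linarith) (by linarith)
  have h4 : |y| ^ p = y ^ (p - 1) * y := by
    rw [abs_of_pos hy, ← Real.rpow_add_one hy.ne', sub_add_cancel]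
  have h5 : |x + y| ^ p - |x| ^ p - p * (|x| ^ (p - 2) * x) * y =
      p * (|c| ^ (p - 2) * c - |x| ^ (p - 2) * x) * y := by
    rw [← hc]
    ring
  rw [h5, h4]
  refine ⟨by positivity, ?_⟩
  calc p * (|c| ^ (p - 2) * c - |x| ^ (p - 2) * x) * y
      ≤ 2 * (2 * y ^ (p - 1)) * y := by gcongr; linarith
    _ = 4 * (y ^ (p - 1) * y) := by ring

/-- The first-order Taylor remainder of `|·| ^ p` is nonnegative and at most `4 |y| ^ p`. -/
lemma abs_add_rpow_sub_mem_Icc {p : ℝ} (hp : 1 < p) (hp2 : p ≤ 2) (x y : ℝ) :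
    |x + y| ^ p - |x| ^ p - p * (|x| ^ (p - 2) * x) * y ∈ Set.Icc 0 (4 * |y| ^ p) := by
  rcases lt_trichotomy y 0 with hy | rfl | hy
  · have h := abs_add_rpow_sub_mem_Icc_of_pos hp hp2 (-x) (neg_pos.2 hy)
    rw [← neg_add, abs_neg, abs_neg, abs_neg] at h
    convert h using 1
    ring
  · simp [Real.zero_rpow (show p ≠ 0 by linarith)]
  · exact abs_add_rpow_sub_mem_Icc_of_pos hp hp2 x hy

/-- The `p`-th power of the `ℓ_p` norm. -/
noncomputable def lpsum (p : ℝ) {n : ℕ} (x : Fin n → ℝ) : ℝ := ∑ i, |x i| ^ p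

/-- The gradient of `lpsum p` at `x`, as a linear functional. -/
noncomputable def lpgrad (p : ℝ) {n : ℕ} (x : Fin n → ℝ) : (Fin n → ℝ) →ₗ[ℝ] ℝ :=
  ∑ i, (p * (|x i| ^ (p - 2) * x i)) • LinearMap.proj i

section lpsum

variable {p : ℝ} {n : ℕ}

lemma lpsum_nonneg (x : Fin n → ℝ) : 0 ≤ lpsum p x :=
  Finset.sum_nonneg fun _ _ ↦ Real.rpow_nonneg (abs_nonneg _) _

lemma rpow_le_one_iff_of_nonneg {a q : ℝ} (ha : 0 ≤ a) (hq : 0 < q) : a ^ q ≤ 1 ↔ a ≤ 1 := by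
  conv_lhs => rw [← Real.one_rpow q]
  exact Real.rpow_le_rpow_iff ha zero_le_one hq

lemma lpnorm_le_one_iff (hp : 0 < p) (x : Fin n → ℝ) : lpnorm p n x ≤ 1 ↔ lpsum p x ≤ 1 :=
  rpow_le_one_iff_of_nonneg (lpsum_nonneg x) (one_div_pos.2 hp)

lemma lpsum_smul (a : ℝ) (x : Fin n → ℝ) : lpsum p (a • x) = |a| ^ p * lpsum p x := by
  simp only [lpsum, Finset.mul_sum, Pi.smul_apply, smul_eq_mul, abs_mul]
  exact Finset.sum_congr rfl fun i _ ↦ Real.mul_rpow (abs_nonneg _) (abs_nonneg _)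

lemma lpsum_zero (hp : 0 < p) : lpsum p (0 : Fin n → ℝ) = 0 := by
  simp [lpsum, Real.zero_rpow hp.ne']

lemma lpsum_neg (x : Fin n → ℝ) : lpsum p (-x) = lpsum p x := by
  simp [lpsum]

lemma continuous_lpsum (hp : 0 < p) : Continuous (lpsum p : (Fin n → ℝ) → ℝ) :=
  continuous_finsetSum _ fun i _ ↦ (continuous_apply i).abs.rpow_const fun _ ↦ Or.inr hp.le

lemma lpsum_eq_norm_rpow (hp : 0 < p) (x : Fin n → ℝ) :
    lpsum p x = ‖WithLp.toLp (ENNReal.ofReal p) x‖ ^ p := by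
  have h : (ENNReal.ofReal p).toReal = p := ENNReal.toReal_ofReal hp.le
  rw [PiLp.norm_eq_sum (by rwa [h]), h, ← Real.rpow_mul, one_div_mul_cancel hp.ne', Real.rpow_one]
  · rfl
  · exact Finset.sum_nonneg fun _ _ ↦ Real.rpow_nonneg (norm_nonneg _) _

lemma lpsum_add_sub_mem_Icc (hp : 1 < p) (hp2 : p ≤ 2) (x y : Fin n → ℝ) :
    lpsum p (x + y) - lpsum p x - lpgrad p x y ∈ Set.Icc 0 (4 * lpsum p y) := by
  have h : lpsum p (x + y) - lpsum p x - lpgrad p x y =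
      ∑ i, (|x i + y i| ^ p - |x i| ^ p - p * (|x i| ^ (p - 2) * x i) * y i) := by
    simp [lpsum, lpgrad, Finset.sum_sub_distrib]
  rw [h, lpsum, Finset.mul_sum]
  exact ⟨Finset.sum_nonneg fun i _ ↦ (abs_add_rpow_sub_mem_Icc hp hp2 _ _).1,
    Finset.sum_le_sum fun i _ ↦ (abs_add_rpow_sub_mem_Icc hp hp2 _ _).2⟩

lemma convexOn_lpsum (hp : 1 < p) (hp2 : p ≤ 2) :
    ConvexOn ℝ Set.univ (lpsum p : (Fin n → ℝ) → ℝ) := by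
  refine ⟨convex_univ, fun x _ y _ a b ha hb hab ↦ ?_⟩
  set z := a • x + b • y with hz
  have h1 := (lpsum_add_sub_mem_Icc hp hp2 z (x - z)).1
  have h2 := (lpsum_add_sub_mem_Icc hp hp2 z (y - z)).1
  rw [add_sub_cancel] at h1 h2
  have h3 : a * lpgrad p z (x - z) + b * lpgrad p z (y - z) = 0 := by
    rw [← smul_eq_mul, ← smul_eq_mul, ← map_smul, ← map_smul, ← map_add]
    have : a • (x - z) + b • (y - z) = 0 := by
      rw [smul_sub, smul_sub, sub_add_sub_comm, ← add_smul, hab, one_smul, ← hz, sub_self]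
    rw [this, map_zero]
  have h4 := mul_nonneg ha h1
  have h5 := mul_nonneg hb h2
  have h6 : a * lpsum p z + b * lpsum p z = lpsum p z := by rw [← add_mul, hab, one_mul]
  simp only [smul_eq_mul]
  linarith

end lpsum

/-- A symmetric slab cut out of an `ℓ_p` ball. -/
def lpslab (p : ℝ) {n : ℕ} (l : (Fin n → ℝ) →ₗ[ℝ] ℝ) (ρ δ : ℝ) : Set (Fin n → ℝ) :=
  {s | lpsum p s ≤ ρ ∧ |l s| ≤ δ}

section lpslab

variable {p ρ δ : ℝ} {n : ℕ} (l : (Fin n → ℝ) →ₗ[ℝ] ℝ)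

lemma isCompact_lpslab (hp : 0 < p) : IsCompact (lpslab p l ρ δ) := by
  refine Metric.isCompact_of_isClosed_isBounded ?_ ?_
  · exact (isClosed_le (continuous_lpsum hp) continuous_const).inter
      (isClosed_le l.continuous_of_finiteDimensional.abs continuous_const)
  · refine (Metric.isBounded_closedBall (x := 0) (r := ρ ^ p⁻¹)).subset fun s hs ↦ ?_
    have hρ : 0 ≤ ρ := (lpsum_nonneg s).trans hs.1
    rw [mem_closedBall_zero_iff, pi_norm_le_iff_of_nonneg (by positivity)]
    intro i
    rw [Real.norm_eq_abs, Real.le_rpow_inv_iff_of_pos (abs_nonneg _) hρ hp]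
    exact (Finset.single_le_sum (f := fun i ↦ |s i| ^ p)
      (fun _ _ ↦ Real.rpow_nonneg (abs_nonneg _) _) (Finset.mem_univ i)).trans hs.1

lemma convex_lpslab (hp : 1 < p) (hp2 : p ≤ 2) : Convex ℝ (lpslab p l ρ δ) := by
  have h1 := (convexOn_lpsum (n := n) hp hp2).convex_le ρ
  have h2 := (convex_Icc (-δ) δ).linear_preimage l
  convert h1.inter h2 using 1
  ext s
  simp [lpslab, abs_le]

lemma interior_lpslab_nonempty (hp : 0 < p) (hρ : 0 < ρ) (hδ : 0 < δ) :
    (interior (lpslab p l ρ δ)).Nonempty := by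
  refine ⟨0, mem_interior.2 ⟨{s | lpsum p s < ρ} ∩ {s | |l s| < δ},
    fun s hs ↦ ⟨hs.1.le, hs.2.le⟩, ?_, ?_⟩⟩
  · exact (isOpen_lt (continuous_lpsum hp) continuous_const).inter
      (isOpen_lt l.continuous_of_finiteDimensional.abs continuous_const)
  · simp [lpsum_zero hp, hρ, hδ]

lemma lpslab_eq_neg : lpslab p l ρ δ = -lpslab p l ρ δ := by
  ext s
  simp [lpslab, lpsum_neg]

end lpslab

/-- Around a point `x` with `lpsum p x ≤ 1 + ε - t`, a single symmetric body covers all nearby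
points whose `lpsum` differs from that of `x` by at most `t / 8`. -/
lemma exists_symmetric_body_of_lpsum_le {p : ℝ} (hp1 : 1 < p) (hp2 : p ≤ 2) {n : ℕ} {ε t : ℝ}
    (hε : 0 < ε) (ht : 0 < t) {x : Fin n → ℝ} (hx : lpsum p x ≤ 1 + ε - t) :
    ∃ S : Set (Fin n → ℝ),
      (IsCompact S ∧ Convex ℝ S ∧ (interior S).Nonempty ∧ S = -S) ∧
      x +ᵥ (2 : ℝ) • S ⊆ (1 + ε) • {x : Fin n → ℝ | lpnorm p n x ≤ 1} ∧
      ∀ y, |lpsum p y - lpsum p x| ≤ t / 8 → lpsum p (y - x) ≤ t / 32 → y ∈ x +ᵥ S := by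
  have hp : 0 < p := by linarith
  refine ⟨lpslab p (lpgrad p x) (t / 32) (t / 4), ⟨isCompact_lpslab _ hp, convex_lpslab _ hp1 hp2,
    interior_lpslab_nonempty _ hp (by positivity) (by positivity), lpslab_eq_neg _⟩, ?_, ?_⟩
  · rintro _ ⟨_, ⟨s, ⟨hs1, hs2⟩, rfl⟩, rfl⟩
    have h1 : (0 : ℝ) < 1 + ε := by linarith
    rw [Set.mem_smul_set_iff_inv_smul_mem₀ h1.ne']
    change lpnorm p n _ ≤ 1
    rw [lpnorm_le_one_iff hp, lpsum_smul, abs_of_pos (inv_pos.2 h1), Real.inv_rpow h1.le,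
      inv_mul_le_one₀ (Real.rpow_pos_of_pos h1 p)]
    have h2 := (lpsum_add_sub_mem_Icc hp1 hp2 x ((2 : ℝ) • s)).2
    have h3 : (2 : ℝ) ^ p ≤ 4 := by
      calc (2 : ℝ) ^ p ≤ 2 ^ (2 : ℝ) := Real.rpow_le_rpow_of_exponent_le (by norm_num) hp2
        _ = 4 := by norm_num
    have h4 : (2 : ℝ) ^ p * lpsum p s ≤ 4 * (t / 32) :=
      mul_le_mul h3 hs1 (lpsum_nonneg s) (by norm_num)
    have h5 : 1 + ε ≤ (1 + ε) ^ p := Real.self_le_rpow_of_one_le (by linarith) hp1.le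
    rw [lpsum_smul, abs_of_pos (by norm_num : (0 : ℝ) < 2), map_smul, smul_eq_mul] at h2
    have h6 := le_of_abs_le hs2
    simp only [vadd_eq_add]
    linarith
  · intro y hy1 hy2
    refine ⟨y - x, ⟨hy2, ?_⟩, by simp⟩
    obtain ⟨h1, h2⟩ := lpsum_add_sub_mem_Icc hp1 hp2 x (y - x)
    rw [add_sub_cancel] at h1 h2
    rw [abs_le] at hy1 ⊢
    constructor <;> linarith

open Module MeasureTheory Metric in
/-- Volume bound on the size of a separated subset of the unit ball. -/
lemma card_le_of_pairwise_lt_norm_sub {E : Type*} [NormedAddCommGroup E] [NormedSpace ℝ E]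
    [FiniteDimensional ℝ E] {r : ℝ} (hr : 0 < r) (s : Finset E) (hs : ∀ c ∈ s, ‖c‖ ≤ 1)
    (h : ∀ c ∈ s, ∀ d ∈ s, c ≠ d → r ≤ ‖c - d‖) :
    (s.card : ℝ) ≤ (1 + 2 / r) ^ finrank ℝ E := by
  borelize E
  let μ : Measure E := Measure.addHaar
  have hδ : 0 < r / 2 := by positivity
  have hρ : 0 < 1 + r / 2 := by positivity
  have hdisj : Set.PairwiseDisjoint (s : Set E) (fun c ↦ ball c (r / 2)) := by
    intro c hc d hd hcd
    apply ball_disjoint_ball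
    rw [dist_eq_norm, add_halves]
    exact h c hc d hd hcd
  have hsub : (⋃ c ∈ s, ball c (r / 2)) ⊆ ball (0 : E) (1 + r / 2) := by
    refine Set.iUnion₂_subset fun x hx ↦ ball_subset_ball' ?_
    rw [dist_zero_right, add_comm]
    linarith [hs x hx]
  have hvol : (s.card : ENNReal) * ENNReal.ofReal ((r / 2) ^ finrank ℝ E) * μ (ball 0 1) ≤
      ENNReal.ofReal ((1 + r / 2) ^ finrank ℝ E) * μ (ball 0 1) :=
    calc _ = μ (⋃ c ∈ s, ball c (r / 2)) := by
          rw [measure_biUnion_finset hdisj fun c _ ↦ measurableSet_ball]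
          simp only [μ.addHaar_ball_of_pos _ hδ, Finset.sum_const, nsmul_eq_mul, mul_assoc]
      _ ≤ μ (ball (0 : E) (1 + r / 2)) := measure_mono hsub
      _ = _ := by rw [μ.addHaar_ball_of_pos _ hρ]
  have hcard := (ENNReal.mul_le_mul_iff_left (measure_ball_pos _ _ zero_lt_one).ne'
    measure_ball_lt_top.ne).1 hvol
  have hreal := ENNReal.toReal_le_of_le_ofReal (pow_nonneg hρ.le _) hcard
  rw [ENNReal.toReal_mul, ENNReal.toReal_natCast, ENNReal.toReal_ofReal (by positivity),
    ← le_div_iff₀ (by positivity), ← div_pow] at hreal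
  rwa [show (1 + r / 2) / (r / 2) = 1 + 2 / r by field_simp; ring] at hreal

open Module in
lemma exists_finset_cover_unitBall {E : Type*} [NormedAddCommGroup E] [NormedSpace ℝ E]
    [FiniteDimensional ℝ E] {r : ℝ} (hr : 0 < r) :
    ∃ s : Finset E, (s.card : ℝ) ≤ (1 + 2 / r) ^ finrank ℝ E ∧
      ∀ x : E, ‖x‖ ≤ 1 → ∃ z ∈ s, ‖x - z‖ ≤ r := by
  classical
  let P : ℕ → Prop := fun k ↦ ∃ s : Finset E, s.card = k ∧ (∀ c ∈ s, ‖c‖ ≤ 1) ∧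
    ∀ c ∈ s, ∀ d ∈ s, c ≠ d → r ≤ ‖c - d‖
  have hP : ∀ k, P k → k ≤ ⌊(1 + 2 / r) ^ finrank ℝ E⌋₊ := by
    rintro _ ⟨s, rfl, h1, h2⟩
    exact Nat.le_floor (card_le_of_pairwise_lt_norm_sub hr s h1 h2)
  obtain ⟨s, hs, h1, h2⟩ : P (Nat.findGreatest P ⌊(1 + 2 / r) ^ finrank ℝ E⌋₊) :=
    Nat.findGreatest_spec (Nat.zero_le _) ⟨∅, by simp⟩
  refine ⟨s, card_le_of_pairwise_lt_norm_sub hr s h1 h2, fun x hx ↦ ?_⟩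
  by_contra! hfar
  have hxs : x ∉ s := fun hxs ↦ by
    have := hfar x hxs
    rw [sub_self, norm_zero] at this
    linarith
  have hins : P (s.card + 1) := by
    refine ⟨insert x s, Finset.card_insert_of_notMem hxs, ?_, ?_⟩
    · simpa [hx] using h1
    · intro c hc d hd hcd
      rcases Finset.mem_insert.1 hc with rfl | hcs <;>
        rcases Finset.mem_insert.1 hd with rfl | hds
      · exact absurd rfl hcd
      · exact (hfar d hds).le
      · rw [norm_sub_rev]
        exact (hfar c hcs).le
      · exact h2 c hcs d hds hcd
  have := Nat.le_findGreatest (hP _ hins) hins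
  omega

/-- The unit ball of `ℓ_p^n` is covered by few sets of small `ℓ_p` diameter. -/
lemma exists_finset_cover_lpsum {p : ℝ} (hp : 1 ≤ p) (n : ℕ) {r : ℝ} (hr : 0 < r) :
    ∃ (s : Finset (PiLp (ENNReal.ofReal p) fun _ : Fin n ↦ ℝ))
      (C : PiLp (ENNReal.ofReal p) (fun _ : Fin n ↦ ℝ) → Set (Fin n → ℝ)),
      (s.card : ℝ) ≤ (1 + 2 / r) ^ n ∧ (∀ x, lpsum p x ≤ 1 → ∃ z ∈ s, x ∈ C z) ∧
      ∀ z, ∀ x ∈ C z, ∀ y ∈ C z, lpsum p (y - x) ≤ (2 * r) ^ p := by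
  have hp0 : 0 < p := by linarith
  have : Fact (1 ≤ ENNReal.ofReal p) := ⟨by simpa using hp⟩
  obtain ⟨s, hs, hcov⟩ :=
    exists_finset_cover_unitBall (E := PiLp (ENNReal.ofReal p) fun _ : Fin n ↦ ℝ) hr
  refine ⟨s, fun z ↦ {x | ‖WithLp.toLp (ENNReal.ofReal p) x - z‖ ≤ r}, ?_, ?_, ?_⟩
  · rwa [(WithLp.linearEquiv (ENNReal.ofReal p) ℝ (Fin n → ℝ)).finrank_eq, Module.finrank_fin_fun]
      at hs
  · intro x hx
    refine hcov _ ?_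
    rwa [lpsum_eq_norm_rpow hp0, rpow_le_one_iff_of_nonneg (norm_nonneg _) hp0] at hx
  · intro z x hx y hy
    rw [lpsum_eq_norm_rpow hp0]
    refine Real.rpow_le_rpow (norm_nonneg _) ?_ hp0.le
    rw [WithLp.toLp_sub, ← sub_sub_sub_cancel_right _ _ z]
    refine (norm_sub_le _ _).trans ?_
    linarith [Set.mem_ofPred_eq ▸ hx, Set.mem_ofPred_eq ▸ hy]

lemma floor_six_mul_add_one_le {L : ℝ} (hL : 1 ≤ L) :
    ((⌊6 * (1 + L)⌋₊ + 1 : ℕ) : ℝ) ≤ 7 * (1 + L) := by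
  push_cast
  linarith [Nat.floor_le (show 0 ≤ 6 * (1 + L) by linarith)]

/-- The number of geometric shells of ratio `9 / 8` needed to cover `[ε, 1 + ε]`. -/
lemma exists_lt_pow_le_lt {ε u : ℝ} (hε : 0 < ε) (hε2 : ε ≤ 1 / 2) (hu : ε ≤ u)
    (hu2 : u ≤ 1 + ε) :
    ∃ k < ⌊6 * (1 + Real.logb 2 (1 / ε))⌋₊ + 1,
      ε * (9 / 8) ^ k ≤ u ∧ u ≤ ε * (9 / 8) ^ k * (9 / 8) := by
  obtain ⟨k, hk1, hk2⟩ := exists_nat_pow_near ((one_le_div hε).2 hu)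
    (show (1 : ℝ) < 9 / 8 by norm_num)
  rw [le_div_iff₀ hε] at hk1
  rw [div_lt_iff₀ hε, pow_succ] at hk2
  refine ⟨k, Nat.lt_succ_of_le (Nat.le_floor ?_), by linarith, by linarith⟩
  have h1 : ((9 : ℝ) / 8) ^ k ≤ 2 * (1 / ε) := by
    rw [mul_one_div, le_div_iff₀ hε]
    linarith
  have h2 : (2 : ℝ) ^ k ≤ (2 * (1 / ε)) ^ 6 := by
    calc (2 : ℝ) ^ k ≤ ((9 / 8) ^ 6) ^ k := by gcongr; norm_num
      _ = ((9 / 8) ^ k) ^ 6 := by rw [← pow_mul, ← pow_mul, mul_comm]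
      _ ≤ _ := by gcongr
  have h3 := Real.logb_le_logb_of_le (b := 2) (by norm_num) (by positivity) h2
  rw [Real.logb_pow, Real.logb_pow, Real.logb_mul (by norm_num) (by positivity),
    Real.logb_self_eq_one (by norm_num)] at h3
  simpa using h3

lemma one_add_two_div_rpow_le {p ε : ℝ} (hp : 1 ≤ p) (hε : 0 < ε) (hε2 : ε ≤ 1 / 2) :
    1 + 2 / (ε / 128) ^ (1 / p) ≤ 257 * (1 / ε) ^ (1 / p) := by
  have hp0 : 0 < p := by linarith
  have h1 : 1 ≤ (1 / ε) ^ (1 / p) :=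
    Real.one_le_rpow ((one_le_div hε).2 (by linarith)) (by positivity)
  have h2 : (128 : ℝ) ^ (1 / p) ≤ 128 :=
    Real.rpow_le_self_of_one_le (by norm_num) ((div_le_one hp0).2 hp)
  have h3 : 2 / (ε / 128) ^ (1 / p) = 2 * (128 ^ (1 / p) * (1 / ε) ^ (1 / p)) := by
    rw [← Real.mul_rpow (by norm_num) (by positivity), mul_one_div, div_eq_mul_inv,
      ← Real.inv_rpow (by positivity), inv_div]
  have h4 : (128 : ℝ) ^ (1 / p) * (1 / ε) ^ (1 / p) ≤ 128 * (1 / ε) ^ (1 / p) := by gcongr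
  linarith

/-- For every fixed `p ∈ (1,2]` there is a constant `c_p > 0` such that for all `n ≥ 1` and
`ε ∈ (0, 1/2]` the unit ball of `ℓ_p^n` admits a symmetric `(2,ε)`-covering by at most
`c_p^n (1 + log₂(1/ε)) (1/ε)^{n/p}` origin-symmetric convex bodies. -/
theorem stmt_13 (p : ℝ) (hp1 : 1 < p) (hp2 : p ≤ 2) :
    ∃ cp : ℝ, 0 < cp ∧ ∀ n : ℕ, 1 ≤ n → ∀ ε : ℝ, 0 < ε → ε ≤ 1 / 2 →
      ∃ (N : ℕ) (c : Fin N → (Fin n → ℝ)) (S : Fin N → Set (Fin n → ℝ)),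
        (N : ℝ) ≤ cp ^ n * (1 + Real.logb 2 (1 / ε)) * (1 / ε) ^ ((n : ℝ) / p) ∧
        (∀ j, IsCompact (S j) ∧ Convex ℝ (S j) ∧ (interior (S j)).Nonempty ∧ S j = -S j) ∧
        {x : Fin n → ℝ | lpnorm p n x ≤ 1} ⊆ ⋃ j, c j +ᵥ S j ∧
        (∀ j, c j +ᵥ (2 : ℝ) • S j ⊆ (1 + ε) • {x : Fin n → ℝ | lpnorm p n x ≤ 1}) := by
  have hp : 0 < p := by linarith
  refine ⟨1799, by norm_num, fun n hn ε hε hε2 ↦ ?_⟩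
  set L := Real.logb 2 (1 / ε) with hLdef
  have hL : 1 ≤ L := by
    rw [hLdef, Real.le_logb_iff_rpow_le (by norm_num) (by positivity), Real.rpow_one,
      le_div_iff₀ hε]
    linarith
  set r := (ε / 128) ^ (1 / p) with hr
  have hr0 : 0 < r := by positivity
  have hrp : (2 * r) ^ p ≤ ε / 32 := by
    have h : (2 : ℝ) ^ p ≤ 2 ^ (2 : ℝ) := Real.rpow_le_rpow_of_exponent_le (by norm_num) hp2
    rw [Real.mul_rpow (by norm_num) hr0.le, hr, ← Real.rpow_mul (by positivity),
      one_div_mul_cancel hp.ne', Real.rpow_one]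
    norm_num at h
    nlinarith
  obtain ⟨s, C, hs, hcov, hdiam⟩ := exists_finset_cover_lpsum hp1.le n hr0
  let A : Fin (⌊6 * (1 + L)⌋₊ + 1) × s → Set (Fin n → ℝ) := fun i ↦
    {y | y ∈ C i.2 ∧ ε * (9 / 8) ^ (i.1 : ℕ) ≤ 1 + ε - lpsum p y ∧
      1 + ε - lpsum p y ≤ ε * (9 / 8) ^ (i.1 : ℕ) * (9 / 8)}
  have hbody : ∀ i, ∃ (c : Fin n → ℝ) (S : Set (Fin n → ℝ)),
      (IsCompact S ∧ Convex ℝ S ∧ (interior S).Nonempty ∧ S = -S) ∧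
      c +ᵥ (2 : ℝ) • S ⊆ (1 + ε) • {x : Fin n → ℝ | lpnorm p n x ≤ 1} ∧ A i ⊆ c +ᵥ S := by
    intro i
    rcases (A i).eq_empty_or_nonempty with hA | ⟨x, hxC, hx1, hx2⟩
    · obtain ⟨S, hS, hS2, -⟩ := exists_symmetric_body_of_lpsum_le hp1 hp2 hε hε
        (x := (0 : Fin n → ℝ)) (by rw [lpsum_zero hp]; linarith)
      exact ⟨0, S, hS, hS2, by simp [hA]⟩
    · obtain ⟨S, hS, hS2, hcov⟩ := exists_symmetric_body_of_lpsum_le hp1 hp2 hε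
        (t := ε * (9 / 8) ^ (i.1 : ℕ)) (by positivity) (x := x) (by linarith)
      refine ⟨x, S, hS, hS2, fun y ⟨hyC, hy1, hy2⟩ ↦ hcov y ?_ ?_⟩
      · rw [abs_le]
        constructor <;> linarith
      · have h1 : ε * 1 ≤ ε * (9 / 8) ^ (i.1 : ℕ) := by
          gcongr
          exact one_le_pow₀ (by norm_num)
        linarith [hdiam _ x hxC y hyC]
  choose c S hS hS2 hAS using hbody
  let e := Fintype.equivFin (Fin (⌊6 * (1 + L)⌋₊ + 1) × s)
  refine ⟨_, c ∘ e.symm, S ∘ e.symm, ?_, fun j ↦ hS _, fun x hx ↦ ?_, fun j ↦ hS2 _⟩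
  · rw [Fintype.card_prod, Fintype.card_fin, Fintype.card_coe, Nat.cast_mul]
    have hX : ((1 / ε) ^ (1 / p)) ^ n = (1 / ε) ^ ((n : ℝ) / p) := by
      rw [← Real.rpow_natCast, ← Real.rpow_mul (by positivity), one_div_mul_eq_div]
    calc
      _ ≤ 7 * (1 + L) * (257 * (1 / ε) ^ (1 / p)) ^ n := by
          refine mul_le_mul (floor_six_mul_add_one_le hL) (hs.trans ?_) (Nat.cast_nonneg _)
            (by linarith)
          exact pow_le_pow_left₀ (by positivity) (one_add_two_div_rpow_le hp1.le hε hε2) n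
      _ = 7 ^ 1 * 257 ^ n * (1 + L) * (1 / ε) ^ ((n : ℝ) / p) := by
          rw [mul_pow, hX]
          ring
      _ ≤ 7 ^ n * 257 ^ n * (1 + L) * (1 / ε) ^ ((n : ℝ) / p) := by
          gcongr
          norm_num
      _ = _ := by
          rw [← mul_pow]
          norm_num
  · have hx1 : lpsum p x ≤ 1 := (lpnorm_le_one_iff hp x).1 hx
    obtain ⟨z, hz, hxz⟩ := hcov x hx1
    obtain ⟨k, hk, hk1, hk2⟩ := exists_lt_pow_le_lt hε hε2
      (show ε ≤ 1 + ε - lpsum p x by linarith) (by linarith [lpsum_nonneg (p := p) x])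
    refine Set.mem_iUnion.2 ⟨e (⟨k, hk⟩, ⟨z, hz⟩), ?_⟩
    simp only [Function.comp_apply, Equiv.symm_apply_apply]
    exact hAS _ ⟨hxz, hk1, hk2⟩
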